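/- Let O ⊂ ℝⁿ (n ≥ 2) be a bounded open set, ϰ > 1, σ ∈ C¹(O) with ϰ⁻¹ ≤ σ ≤ ϰ and |∇σ| ≤ ϰ on O, and u ∈ C²(O) with div(σ∇u) = 0 in O. Let δ > 0, x ∈ O with dist(x,∂O) > δ, and let N* ≥ 0 be such that H(x,ρ) > 0 and ρ D(x,ρ)/H(x,ρ) ≤ N* for every ρ ∈ (0,δ). Then: (i) for all 0 < r ≤ ρ ≤ δ, H(x,ρ)/ρ^{n−1} ≤ e^{ϰ²(ρ−r)} (ρ/r)^{2N*} H(x,r)/r^{n−1}; and (ii) for every 0 < r < δ, K(x,δ) ≤ e^{ϰ²δ} (δ/r)^{2N* + n} K(x,r), and consequently ∫_{B(x,δ)} u² dx ≤ ϰ² e^{ϰ²δ} (δ/r)^{2N* + n} ∫_{B(x,r)} u² dx. -/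

import Mathlib

open MeasureTheory Metric Set
open scoped RealInnerProductSpace

noncomputable section

abbrev Euc (n : ℕ) := EuclideanSpace ℝ (Fin n)

/-- Divergence of a vector field on `ℝⁿ`. -/
noncomputable def vdiv {n : ℕ} (F : Euc n → Euc n) (x : Euc n) : ℝ :=
  ∑ i, fderiv ℝ F x (EuclideanSpace.single i 1) i

/-- Surface integral over the sphere `∂B(x₀,r)`:
`∫_{∂B(x₀,r)} f dS = r^{n−1} ∫_{S^{n−1}} f(x₀+rθ) dσ(θ)`, where `σ` is the
surface measure `volume.toSphere` on the unit sphere. -/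
noncomputable def sphIntB (n : ℕ) (x₀ : Euc n) (r : ℝ) (f : Euc n → ℝ) : ℝ :=
  r ^ (n - 1) *
    ∫ θ : Metric.sphere (0 : Euc n) 1, f (x₀ + r • (θ : Euc n))
      ∂((volume : Measure (Euc n)).toSphere)

/-- `H(x₀,r) = ∫_{∂B(x₀,r)} σ u² dS`. -/
noncomputable def Hfn {n : ℕ} (σ u : Euc n → ℝ) (x₀ : Euc n) (r : ℝ) : ℝ :=
  sphIntB n x₀ r (fun y => σ y * u y ^ 2)

/-- `D(x₀,r) = ∫_{B(x₀,r)} σ |∇u|² dx`. -/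
noncomputable def Dfn {n : ℕ} (σ u : Euc n → ℝ) (x₀ : Euc n) (r : ℝ) : ℝ :=
  ∫ x in ball x₀ r, σ x * ‖gradient u x‖ ^ 2

/-- `K(x₀,r) = ∫_{B(x₀,r)} σ u² dx`. -/
noncomputable def Kfn {n : ℕ} (σ u : Euc n → ℝ) (x₀ : Euc n) (r : ℝ) : ℝ :=
  ∫ x in ball x₀ r, σ x * u x ^ 2

/-- `H̃(x₀,r) = ∫_{∂B(x₀,r)} u² ∇σ·ν dS`, with `ν(x₀+rθ) = θ`. -/
noncomputable def Htilde {n : ℕ} (σ u : Euc n → ℝ) (x₀ : Euc n) (r : ℝ) : ℝ :=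
  r ^ (n - 1) *
    ∫ θ : Metric.sphere (0 : Euc n) 1,
      u (x₀ + r • (θ : Euc n)) ^ 2 * ⟪gradient σ (x₀ + r • (θ : Euc n)), (θ : Euc n)⟫
      ∂((volume : Measure (Euc n)).toSphere)

/-- `Ĥ(x₀,r) = ∫_{∂B(x₀,r)} σ (∂_ν u)² dS`, with `∂_ν u(x₀+rθ) = ∇u(x₀+rθ)·θ`. -/
noncomputable def Hhat {n : ℕ} (σ u : Euc n → ℝ) (x₀ : Euc n) (r : ℝ) : ℝ :=
  r ^ (n - 1) *
    ∫ θ : Metric.sphere (0 : Euc n) 1,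
      σ (x₀ + r • (θ : Euc n)) * ⟪gradient u (x₀ + r • (θ : Euc n)), (θ : Euc n)⟫ ^ 2
      ∂((volume : Measure (Euc n)).toSphere)

/-- `D̃(x₀,r) = ∫_{B(x₀,r)} |∇u|² ∇σ·(x−x₀) dx`. -/
noncomputable def Dtilde {n : ℕ} (σ u : Euc n → ℝ) (x₀ : Euc n) (r : ℝ) : ℝ :=
  ∫ x in ball x₀ r, ‖gradient u x‖ ^ 2 * ⟪gradient σ x, x - x₀⟫

/-- Integration in polar coordinates centred at `x₀`. -/
theorem integral_eq_integral_Ioi_sphere {n : ℕ} [NeZero n] (x₀ : Euc n) {f : Euc n → ℝ}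
    (hf : Integrable f) :
    ∫ y, f y = ∫ t in Ioi (0 : ℝ), sphIntB n x₀ t f := by
  have hmp := (volume : Measure (Euc n)).measurePreserving_homeomorphUnitSphereProd
  have hemb := (homeomorphUnitSphereProd (Euc n)).measurableEmbedding
  set F : sphere (0 : Euc n) 1 × Ioi (0 : ℝ) → ℝ := fun p => f (x₀ + (p.2 : ℝ) • (p.1 : Euc n))
    with hF
  have hFc : ∀ y : ({0}ᶜ : Set (Euc n)), F (homeomorphUnitSphereProd (Euc n) y) = f (x₀ + y) := by
    intro y
    simp only [hF]
    rw [← homeomorphUnitSphereProd_symm_apply_coe, Homeomorph.symm_apply_apply]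
  have hf' : Integrable fun y => f (x₀ + y) := hf.comp_add_left x₀
  have hFi : Integrable F ((volume : Measure (Euc n)).toSphere.prod
      (Measure.volumeIoiPow (Module.finrank ℝ (Euc n) - 1))) := by
    rw [← hmp.integrable_comp_emb hemb]
    have : F ∘ homeomorphUnitSphereProd (Euc n) = (fun y => f (x₀ + y)) ∘ Subtype.val :=
      funext hFc
    rw [this, ← integrableOn_iff_comap_subtypeVal (measurableSet_singleton _).compl]
    exact hf'.integrableOn
  calc
    ∫ y, f y = ∫ y, f (x₀ + y) := (integral_add_left_eq_self f x₀).symm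
    _ = ∫ y : ({0}ᶜ : Set (Euc n)), f (x₀ + y) ∂(Measure.comap Subtype.val volume) := by
      rw [integral_subtype_comap (measurableSet_singleton _).compl fun y => f (x₀ + y),
        restrict_compl_singleton]
    _ = ∫ p, F p ∂_ := by
      rw [← hmp.integral_comp hemb]
      exact integral_congr_ae (.of_forall fun y => (hFc y).symm)
    _ = _ := by
      rw [integral_prod_symm _ hFi]
      simp only [Measure.volumeIoiPow, ENNReal.ofReal, finrank_euclideanSpace_fin]
      rw [integral_withDensity_eq_integral_smul
        ((measurable_subtype_coe.pow_const _).real_toNNReal),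
        integral_subtype_comap measurableSet_Ioi fun a : ℝ => Real.toNNReal (a ^ (n - 1)) •
          ∫ θ, f (x₀ + a • (θ : Euc n)) ∂((volume : Measure (Euc n)).toSphere)]
      refine setIntegral_congr_fun measurableSet_Ioi fun t ht => ?_
      simp only [sphIntB]
      rw [NNReal.smul_def, Real.coe_toNNReal _ (pow_nonneg (le_of_lt ht) _), smul_eq_mul]

theorem integrable_sphere_of_continuous {n : ℕ} {g : sphere (0 : Euc n) 1 → ℝ}
    (hg : Continuous g) : Integrable g ((volume : Measure (Euc n)).toSphere) :=
  hg.integrable_of_hasCompactSupport (HasCompactSupport.of_compactSpace g)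

theorem continuous_integral_sphere {n : ℕ}
    {f : ℝ → sphere (0 : Euc n) 1 → ℝ} (hf : Continuous (Function.uncurry f)) :
    Continuous fun s : ℝ => ∫ θ, f s θ ∂((volume : Measure (Euc n)).toSphere) := by
  simpa using continuous_parametric_integral_of_continuous
    (μ := (volume : Measure (Euc n)).toSphere) hf isCompact_univ

theorem continuous_sphIntB {n : ℕ} (x₀ : Euc n) {f : Euc n → ℝ} (hf : Continuous f) :
    Continuous fun s => sphIntB n x₀ s f :=
  (continuous_pow _).mul (continuous_integral_sphere
    (f := fun (s : ℝ) (θ : sphere (0 : Euc n) 1) => f (x₀ + s • (θ : Euc n)))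
    (by simp only [Function.uncurry_def]; fun_prop))

theorem continuous_sphere_flux {n : ℕ} (x₀ : Euc n) {V : Euc n → Euc n} (hV : Continuous V) :
    Continuous fun s : ℝ => s ^ (n - 1) * ∫ θ : sphere (0 : Euc n) 1,
      ⟪(θ : Euc n), V (x₀ + s • (θ : Euc n))⟫ ∂((volume : Measure (Euc n)).toSphere) :=
  (continuous_pow _).mul (continuous_integral_sphere
    (f := fun (s : ℝ) (θ : sphere (0 : Euc n) 1) => ⟪(θ : Euc n), V (x₀ + s • (θ : Euc n))⟫)
    (by simp only [Function.uncurry_def]; fun_prop))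

theorem setIntegral_ball_eq_intervalIntegral {n : ℕ} [NeZero n] (x₀ : Euc n) {f : Euc n → ℝ}
    (hf : Continuous f) {ρ : ℝ} (hρ : 0 ≤ ρ) :
    ∫ y in ball x₀ ρ, f y = ∫ t in (0 : ℝ)..ρ, sphIntB n x₀ t f := by
  have hi : IntegrableOn f (ball x₀ ρ) :=
    (hf.continuousOn.integrableOn_compact (isCompact_closedBall x₀ ρ)).mono_set
      ball_subset_closedBall
  rw [← integral_indicator measurableSet_ball, integral_eq_integral_Ioi_sphere x₀
    (hi.integrable_indicator measurableSet_ball), intervalIntegral.integral_of_le hρ,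
    integral_Ioc_eq_integral_Ioo, ← Ioi_inter_Iio, ← setIntegral_indicator measurableSet_Iio]
  refine setIntegral_congr_fun measurableSet_Ioi fun t (ht : 0 < t) => ?_
  have hmem : ∀ θ : sphere (0 : Euc n) 1, x₀ + t • (θ : Euc n) ∈ ball x₀ ρ ↔ t ∈ Iio ρ := by
    intro θ
    simp [norm_smul, abs_of_pos ht]
  by_cases h : t ∈ Iio ρ
  · simp only [sphIntB, indicator_of_mem h, indicator_of_mem ((hmem _).2 h)]
  · simp only [sphIntB, indicator_of_notMem h, indicator_of_notMem (fun h' => h ((hmem _).1 h')),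
      integral_zero, mul_zero]

theorem integral_vdiv_eq_zero {n : ℕ} {W : Euc n → Euc n} (hW : ContDiff ℝ 1 W)
    (hc : HasCompactSupport W) : ∫ y, vdiv W y = 0 := by
  have hd : Differentiable ℝ W := hW.differentiable one_ne_zero
  have hcd : Continuous (fderiv ℝ W) := hW.continuous_fderiv one_ne_zero
  have hint : ∀ i, Integrable fun y => fderiv ℝ W y (EuclideanSpace.single i 1) i := by
    intro i
    refine Continuous.integrable_of_hasCompactSupport (by fun_prop) ?_
    refine (hc.fderiv (𝕜 := ℝ)).mono fun y hy => ?_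
    rw [Function.mem_support] at hy ⊢
    intro h
    simp [h] at hy
  unfold vdiv
  rw [integral_finsetSum _ fun i _ => hint i]
  refine Finset.sum_eq_zero fun i _ => ?_
  have hcoord : ∀ y v, fderiv ℝ (fun z => W z i) y v = fderiv ℝ W y v i := by
    intro y v
    have h : HasFDerivAt (fun z => W z i) ((EuclideanSpace.proj i).comp (fderiv ℝ W y)) y :=
      (EuclideanSpace.proj (𝕜 := ℝ) i).hasFDerivAt.comp y (hd y).hasFDerivAt
    rw [h.fderiv]
    rfl
  have hi0 : Integrable fun y => W y i := by
    have := hW.continuous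
    refine Continuous.integrable_of_hasCompactSupport (by fun_prop) (hc.mono fun y hy => ?_)
    rw [Function.mem_support] at hy ⊢
    intro h
    simp [h] at hy
  have := integral_mul_fderiv_eq_neg_fderiv_mul_of_integrable (μ := (volume : Measure (Euc n)))
    (f := fun _ => (1 : ℝ)) (g := fun y => W y i) (v := EuclideanSpace.single i 1)
    (by simp) (by simpa [hcoord] using hint i) (by simpa using hi0) (by fun_prop)
    (fun y _ => by fun_prop)
  simpa [hcoord] using this

theorem vdiv_smul {n : ℕ} {φ : Euc n → ℝ} {V : Euc n → Euc n} {y : Euc n}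
    (hφ : DifferentiableAt ℝ φ y) (hV : DifferentiableAt ℝ V y) :
    vdiv (fun z => φ z • V z) y = φ y * vdiv V y + fderiv ℝ φ y (V y) := by
  have hsum : V y = ∑ i, V y i • EuclideanSpace.single i (1 : ℝ) := by
    simpa using ((EuclideanSpace.basisFun (Fin n) ℝ).sum_repr (V y)).symm
  unfold vdiv
  rw [fderiv_fun_smul hφ hV]
  conv_rhs => rw [hsum]
  simp [Finset.sum_add_distrib, Finset.mul_sum, mul_comm]

/-- Weak form of the divergence theorem on spheres: test the divergence against the radial function
`-∫_{‖y - x₀‖}^∞ k`. -/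
theorem integral_mul_sphere_flux_sub_eq_zero {n : ℕ} [NeZero n] (x₀ : Euc n) {V : Euc n → Euc n}
    (hV : ContDiff ℝ 1 V) {k : ℝ → ℝ} (hk : Continuous k) (hkc : HasCompactSupport k)
    (hks : tsupport k ⊆ Ioi 0) :
    ∫ s, k s * ((s ^ (n - 1) * ∫ θ : sphere (0 : Euc n) 1, ⟪(θ : Euc n), V (x₀ + s • (θ : Euc n))⟫
        ∂((volume : Measure (Euc n)).toSphere)) -
      ∫ t in (0 : ℝ)..s, sphIntB n x₀ t (vdiv V)) = 0 := by
  have hVc : Continuous V := hV.continuous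
  have hVd : Continuous (fderiv ℝ V) := hV.continuous_fderiv one_ne_zero
  have hdiv : Continuous (vdiv V) := by unfold vdiv; fun_prop
  set A : ℝ → ℝ := fun s => sphIntB n x₀ s (vdiv V) with hA
  set B : ℝ → ℝ := fun s => s ^ (n - 1) * ∫ θ : sphere (0 : Euc n) 1,
    ⟪(θ : Euc n), V (x₀ + s • (θ : Euc n))⟫ ∂((volume : Measure (Euc n)).toSphere) with hB
  have hAc : Continuous A := continuous_sphIntB x₀ hdiv
  have hBc : Continuous B := continuous_sphere_flux x₀ hVc
  set F : ℝ → ℝ := fun s => ∫ t in (0 : ℝ)..s, A t with hF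
  have hFd : ∀ s, HasDerivAt F (A s) s := fun s =>
    intervalIntegral.integral_hasDerivAt_right (hAc.intervalIntegrable _ _)
      hAc.aestronglyMeasurable.stronglyMeasurableAtFilter hAc.continuousAt
  have hFc : Continuous F := continuous_iff_continuousAt.2 fun s => (hFd s).continuousAt
  obtain ⟨b, hb0, hb⟩ : ∃ b : ℝ, 0 < b ∧ ∀ s, b ≤ s → k s = 0 := by
    obtain ⟨b, hb⟩ := hkc.isCompact.bddAbove
    refine ⟨max b 0 + 1, by positivity, fun s hs => image_eq_zero_of_notMem_tsupport fun h => ?_⟩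
    have := hb h
    have := le_max_left b 0
    linarith
  set G : ℝ → ℝ := fun s => ∫ t in b..s, k t with hG
  have hGd : ∀ s, HasDerivAt G (k s) s := fun s =>
    intervalIntegral.integral_hasDerivAt_right (hk.intervalIntegrable _ _)
      hk.aestronglyMeasurable.stronglyMeasurableAtFilter hk.continuousAt
  have hGc : Continuous G := continuous_iff_continuousAt.2 fun s => (hGd s).continuousAt
  have hG1 : ContDiff ℝ 1 G := by
    rw [contDiff_one_iff_deriv]
    refine ⟨fun s => (hGd s).differentiableAt, ?_⟩
    rwa [funext fun s => (hGd s).deriv]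
  have hGb : ∀ s, b ≤ s → G s = 0 := by
    intro s hs
    rw [hG]
    simp only
    rw [intervalIntegral.integral_congr (g := fun _ => (0 : ℝ))]
    · simp
    · intro t ht
      rw [uIcc_of_le hs] at ht
      exact hb t ht.1
  obtain ⟨a, ha0, ha⟩ : ∃ a : ℝ, 0 < a ∧ ∀ s, |s| < a → k s = 0 := by
    have h0 : (0 : ℝ) ∉ tsupport k := fun h => lt_irrefl (0 : ℝ) (hks h)
    obtain ⟨a, ha0, ha⟩ := Metric.isOpen_iff.1 (isClosed_tsupport k).isOpen_compl 0 h0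
    refine ⟨a, ha0, fun s hs => image_eq_zero_of_notMem_tsupport (ha ?_)⟩
    simpa using hs
  have hGa : ∀ s, |s| < a → G s = G 0 := by
    intro s hs
    rw [hG]
    simp only
    rw [← sub_eq_zero, intervalIntegral.integral_interval_sub_left (hk.intervalIntegrable _ _)
      (hk.intervalIntegrable _ _), intervalIntegral.integral_congr (g := fun _ => (0 : ℝ))]
    · simp
    · intro t ht
      refine ha t (lt_of_le_of_lt ?_ hs)
      simpa using abs_sub_left_of_mem_uIcc ht
  set φ : Euc n → ℝ := fun y => G ‖y - x₀‖ with hφ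
  have hφ1 : ContDiff ℝ 1 φ := by
    rw [contDiff_iff_contDiffAt]
    intro y
    by_cases hy : y = x₀
    · have : φ =ᶠ[nhds y] fun _ => G 0 := by
        filter_upwards [Metric.ball_mem_nhds y ha0] with z hz
        refine hGa _ ?_
        rw [abs_norm, ← dist_eq_norm, ← hy]
        exact hz
      exact contDiffAt_const.congr_of_eventuallyEq this
    · exact hG1.contDiffAt.comp y
        ((contDiffAt_id.sub contDiffAt_const).norm ℝ (sub_ne_zero.2 hy))
  have hφd : ∀ (s : ℝ), 0 < s → ∀ (θ : sphere (0 : Euc n) 1) (v : Euc n),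
      fderiv ℝ φ (x₀ + s • (θ : Euc n)) v = k s * ⟪(θ : Euc n), v⟫ := by
    intro s hs θ v
    have hθ : ‖(θ : Euc n)‖ = 1 := by simp
    have hns : ‖s • (θ : Euc n)‖ = s := by
      rw [norm_smul, hθ, Real.norm_eq_abs, abs_of_pos hs, mul_one]
    set y := x₀ + s • (θ : Euc n) with hy
    have hyx : y - x₀ = s • (θ : Euc n) := by simp [hy]
    have h1 : HasFDerivAt (fun z : Euc n => ‖z - x₀‖ ^ 2)
        (2 • (innerSL ℝ (y - x₀)).comp (ContinuousLinearMap.id ℝ (Euc n))) y :=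
      ((hasFDerivAt_id y).sub_const x₀).norm_sq
    have h2 := h1.sqrt (by rw [hyx, hns]; positivity)
    simp only [Real.sqrt_sq (norm_nonneg _)] at h2
    have h3 := (hGd ‖y - x₀‖).comp_hasFDerivAt y h2
    change fderiv ℝ (G ∘ fun z => ‖z - x₀‖) y v = _
    rw [h3.fderiv, hyx, hns]
    simp
    field_simp
    simp
  have hφs : ∀ y, b ≤ ‖y - x₀‖ → φ y = 0 := fun y hy => hGb _ hy
  set W : Euc n → Euc n := fun y => φ y • V y with hW
  have hW1 : ContDiff ℝ 1 W := hφ1.smul hV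
  have hWc : HasCompactSupport W := by
    refine HasCompactSupport.intro (isCompact_closedBall x₀ b) fun y hy => ?_
    rw [mem_closedBall, dist_eq_norm, not_le] at hy
    simp [hW, hφs y hy.le]
  have hWdiv : Continuous (vdiv W) := by
    have := hW1.continuous_fderiv one_ne_zero
    unfold vdiv; fun_prop
  have hWdc : HasCompactSupport (vdiv W) := by
    refine (hWc.fderiv (𝕜 := ℝ)).mono fun y hy => ?_
    rw [Function.mem_support] at hy ⊢
    intro h
    simp [vdiv, h] at hy
  have hpol := integral_eq_integral_Ioi_sphere x₀
    (hWdiv.integrable_of_hasCompactSupport hWdc)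
  rw [integral_vdiv_eq_zero hW1 hWc] at hpol
  have hslice : ∀ s ∈ Ioi (0 : ℝ), sphIntB n x₀ s (vdiv W) = G s * A s + k s * B s := by
    intro s (hs : 0 < s)
    have hpt : ∀ θ : sphere (0 : Euc n) 1, vdiv W (x₀ + s • (θ : Euc n)) =
        G s * vdiv V (x₀ + s • (θ : Euc n)) + k s * ⟪(θ : Euc n), V (x₀ + s • (θ : Euc n))⟫ := by
      intro θ
      rw [hW, vdiv_smul (hφ1.differentiable one_ne_zero _) (hV.differentiable one_ne_zero _),
        hφd s hs]
      simp [hφ, norm_smul, abs_of_pos hs]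
    simp only [sphIntB, hpt, hA, hB]
    rw [integral_add (integrable_sphere_of_continuous (by fun_prop))
      (integrable_sphere_of_continuous (by fun_prop)), integral_const_mul, integral_const_mul]
    ring
  rw [setIntegral_congr_fun measurableSet_Ioi hslice] at hpol
  have htrunc : ∫ s in Ioi (0 : ℝ), (G s * A s + k s * B s) =
      ∫ s in (0 : ℝ)..b, (G s * A s + k s * B s) := by
    rw [intervalIntegral.integral_of_le hb0.le]
    refine setIntegral_eq_of_subset_of_forall_sdiff_eq_zero measurableSet_Ioi Ioc_subset_Ioi_self ?_
    intro s hs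
    have : b < s := by
      by_contra h
      exact hs.2 ⟨hs.1, not_lt.1 h⟩
    simp [hGb s this.le, hb s this.le]
  have hparts := intervalIntegral.integral_deriv_mul_eq_sub (a := 0) (b := b) (fun s _ => hGd s)
    (fun s _ => hFd s) (hk.intervalIntegrable _ _) (hAc.intervalIntegrable _ _)
  have hF0 : F 0 = 0 := by simp [hF]
  rw [hGb b le_rfl, hF0] at hparts
  have hfull : ∫ s, k s * (B s - F s) = ∫ s in (0 : ℝ)..b, k s * (B s - F s) := by
    rw [intervalIntegral.integral_of_le hb0.le, setIntegral_eq_integral_of_forall_compl_eq_zero]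
    intro s hs
    rcases le_or_gt s 0 with h | h
    · rw [image_eq_zero_of_notMem_tsupport fun h' => not_lt.2 h (hks h'), zero_mul]
    · rw [hb s (not_lt.1 fun h' => hs ⟨h, h'.le⟩), zero_mul]
  rw [hfull]
  have hsub : ∫ s in (0 : ℝ)..b, k s * (B s - F s) =
      (∫ s in (0 : ℝ)..b, (G s * A s + k s * B s)) -
        ∫ s in (0 : ℝ)..b, (k s * F s + G s * A s) := by
    rw [← intervalIntegral.integral_sub]
    · exact intervalIntegral.integral_congr fun s _ => by ring
    · exact Continuous.intervalIntegrable (by fun_prop) _ _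
    · exact Continuous.intervalIntegrable (by fun_prop) _ _
  rw [hsub, ← htrunc, ← hpol, hparts]
  simp

/-- The **divergence theorem** on a Euclidean ball, for a continuously differentiable field. -/
theorem integral_sphere_flux_eq_integral_ball_vdiv {n : ℕ} [NeZero n] (x₀ : Euc n)
    {V : Euc n → Euc n} (hV : ContDiff ℝ 1 V) {ρ : ℝ} (hρ : 0 < ρ) :
    ρ ^ (n - 1) * ∫ θ : sphere (0 : Euc n) 1, ⟪(θ : Euc n), V (x₀ + ρ • (θ : Euc n))⟫
        ∂((volume : Measure (Euc n)).toSphere) = ∫ y in ball x₀ ρ, vdiv V y := by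
  have hVc : Continuous V := hV.continuous
  have hVd : Continuous (fderiv ℝ V) := hV.continuous_fderiv one_ne_zero
  have hdiv : Continuous (vdiv V) := by unfold vdiv; fun_prop
  rw [setIntegral_ball_eq_intervalIntegral x₀ hdiv hρ.le]
  have hBc := continuous_sphere_flux x₀ hVc
  have hFc : Continuous fun s => ∫ t in (0 : ℝ)..s, sphIntB n x₀ t (vdiv V) :=
    intervalIntegral.continuous_primitive
      (fun _ _ => (continuous_sphIntB x₀ hdiv).intervalIntegrable _ _) 0
  have hae := isOpen_Ioi.ae_eq_zero_of_integral_contDiff_smul_eq_zero (U := Ioi (0 : ℝ))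
    (μ := volume) ((hBc.sub hFc).locallyIntegrable.locallyIntegrableOn _)
    fun k hk hkc hks => integral_mul_sphere_flux_sub_eq_zero x₀ hV hk.continuous hkc hks
  have heq := Measure.eqOn_open_of_ae_eq (μ := volume)
    ((ae_restrict_iff' measurableSet_Ioi).2 hae) isOpen_Ioi (hBc.sub hFc).continuousOn
    (continuousOn_const (c := (0 : ℝ)))
  exact sub_eq_zero.1 (heq hρ)

/-- Differentiation of spherical means with respect to the radius. -/
theorem hasDerivAt_integral_sphere {n : ℕ} (x₀ : Euc n) {f : Euc n → ℝ} (hf : ContDiff ℝ 1 f)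
    (s : ℝ) :
    HasDerivAt (fun t : ℝ => ∫ θ : sphere (0 : Euc n) 1, f (x₀ + t • (θ : Euc n))
        ∂((volume : Measure (Euc n)).toSphere))
      (∫ θ : sphere (0 : Euc n) 1, fderiv ℝ f (x₀ + s • (θ : Euc n)) θ
        ∂((volume : Measure (Euc n)).toSphere)) s := by
  have hfc : Continuous f := hf.continuous
  have hfd : Continuous (fderiv ℝ f) := hf.continuous_fderiv one_ne_zero
  have hi {g : sphere (0 : Euc n) 1 → ℝ} := integrable_sphere_of_continuous (g := g)
  have hc : Continuous fun p : ℝ × sphere (0 : Euc n) 1 =>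
      fderiv ℝ f (x₀ + p.1 • (p.2 : Euc n)) p.2 := by fun_prop
  obtain ⟨C, hC⟩ := ((isCompact_Icc (a := s - 1) (b := s + 1)).prod
    (isCompact_univ (X := sphere (0 : Euc n) 1))).exists_bound_of_continuousOn hc.continuousOn
  refine (hasDerivAt_integral_of_dominated_loc_of_deriv_le (bound := fun _ => C)
    (F := fun (t : ℝ) (θ : sphere (0 : Euc n) 1) => f (x₀ + t • (θ : Euc n)))
    (F' := fun (t : ℝ) (θ : sphere (0 : Euc n) 1) => fderiv ℝ f (x₀ + t • (θ : Euc n)) θ)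
    (Icc_mem_nhds (sub_one_lt s) (lt_add_one s))
    (.of_forall fun t => (hi (by fun_prop)).aestronglyMeasurable) (hi (by fun_prop))
    (hi (by fun_prop)).aestronglyMeasurable
    (.of_forall fun θ t ht => hC (t, θ) ⟨ht, mem_univ _⟩) (hi continuous_const)
    (.of_forall fun θ t _ => ?_)).2
  have hline : HasDerivAt (fun t : ℝ => x₀ + t • (θ : Euc n)) (θ : Euc n) t := by
    simpa using ((hasDerivAt_id t).smul_const (θ : Euc n)).const_add x₀
  exact (hf.differentiable one_ne_zero _).hasFDerivAt.comp_hasDerivAt t hline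

theorem ContDiffOn.exists_contDiff_eqOn_closedBall {E F : Type*} [NormedAddCommGroup E]
    [NormedSpace ℝ E] [HasContDiffBump E] [NormedAddCommGroup F] [NormedSpace ℝ F] {m : ℕ∞}
    {f : E → F} {O : Set E} (hf : ContDiffOn ℝ m f O) (hO : IsOpen O) {x : E} {δ R : ℝ} (hδ : 0 < δ)
    (hδR : δ < R) (hR : closedBall x R ⊆ O) :
    ∃ g : E → F, ContDiff ℝ m g ∧ EqOn g f (closedBall x δ) := by
  let χ : ContDiffBump x := ⟨δ, R, hδ, hδR⟩
  refine ⟨fun y => χ y • f y, contDiff_iff_contDiffAt.2 fun y => ?_, fun y hy => ?_⟩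
  · by_cases hy : y ∈ closedBall x R
    · exact χ.contDiff.contDiffAt.smul (hf.contDiffAt (hO.mem_nhds (hR hy)))
    · refine (contDiffAt_const (c := (0 : F))).congr_of_eventuallyEq ?_
      filter_upwards [isClosed_closedBall.isOpen_compl.mem_nhds hy] with z hz
      have : R ≤ Dist.dist z x := (not_le.1 (mem_closedBall.not.1 hz)).le
      simp [χ.zero_of_le_dist this]
  · simp [χ.one_of_mem_closedBall hy]

theorem ball_infDist_frontier_subset {E : Type*} [NormedAddCommGroup E] [NormedSpace ℝ E]
    [FiniteDimensional ℝ E] {O : Set E} {x : E} (hx : x ∈ O) :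
    ball x (infDist x (frontier O)) ⊆ O := by
  by_cases hO : O = univ
  · exact hO ▸ subset_univ _
  · obtain ⟨y, hy, hxy⟩ := exists_mem_frontier_infDist_compl_eq_dist hx hO
    exact (ball_subset_ball ((infDist_le_dist_of_mem hy).trans_eq hxy.symm)).trans
      ball_infDist_compl_subset

/-- Gronwall-type estimate for `h' ≤ (C + N / s) h`. -/
theorem le_exp_mul_rpow_mul_of_deriv_le {h h' : ℝ → ℝ} {r ρ C N : ℝ} (hr : 0 < r) (hrρ : r ≤ ρ)
    (hc : ContinuousOn h (Icc r ρ)) (hd : ∀ s ∈ Ioo r ρ, HasDerivAt h (h' s) s)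
    (hle : ∀ s ∈ Ioo r ρ, h' s ≤ (C + N / s) * h s) :
    h ρ ≤ Real.exp (C * (ρ - r)) * (ρ / r) ^ N * h r := by
  have hρ : 0 < ρ := hr.trans_le hrρ
  set w : ℝ → ℝ := fun s => Real.exp (-(C * s)) * s ^ (-N) with hw
  have hwd : ∀ s, 0 < s → HasDerivAt w (-(C + N / s) * w s) s := by
    intro s hs
    have h1 : HasDerivAt (fun s : ℝ => Real.exp (-(C * s))) (Real.exp (-(C * s)) * -C) s := by
      simpa using ((hasDerivAt_id s).const_mul C).neg.exp
    have h2 := Real.hasDerivAt_rpow_const (x := s) (p := -N) (Or.inl hs.ne')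
    refine (h1.mul h2).congr_deriv ?_
    simp only [hw]
    rw [Real.rpow_sub_one hs.ne']
    field_simp
    ring
  have hanti : AntitoneOn (fun s => h s * w s) (Icc r ρ) := by
    have hderiv : ∀ s ∈ Ioo r ρ, HasDerivAt (fun s => h s * w s)
        (h' s * w s + h s * (-(C + N / s) * w s)) s := fun s hs =>
      (hd s hs).mul (hwd s (hr.trans hs.1))
    refine antitoneOn_of_deriv_nonpos (convex_Icc r ρ) (hc.mul fun s hs =>
      (hwd s (hr.trans_le hs.1)).continuousAt.continuousWithinAt) ?_ ?_
    · rw [interior_Icc]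
      exact fun s hs => (hderiv s hs).differentiableAt.differentiableWithinAt
    · rw [interior_Icc]
      intro s hs
      have hs0 : 0 < s := hr.trans hs.1
      have hw0 : 0 ≤ w s := by positivity
      rw [(hderiv s hs).deriv]
      nlinarith [mul_le_mul_of_nonneg_right (hle s hs) hw0]
  have hmain : h ρ * w ρ ≤ h r * w r := hanti ⟨le_rfl, hrρ⟩ ⟨hrρ, le_rfl⟩ hrρ
  have hwρ : 0 < w ρ := by positivity
  have hquot : Real.exp (C * (ρ - r)) * (ρ / r) ^ N * w ρ = w r := by
    have hρN := (Real.rpow_pos_of_pos hρ N).ne'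
    have hrN := (Real.rpow_pos_of_pos hr N).ne'
    simp only [hw]
    rw [Real.div_rpow hρ.le hr.le, Real.rpow_neg hρ.le, Real.rpow_neg hr.le,
      show -(C * r) = C * (ρ - r) + -(C * ρ) by ring, Real.exp_add]
    field_simp
  refine le_of_mul_le_mul_right ?_ hwρ
  calc h ρ * w ρ ≤ h r * w r := hmain
    _ = _ := by rw [← hquot]; ring

theorem inner_gradient_eq_fderiv {n : ℕ} (f : Euc n → ℝ) (y v : Euc n) :
    ⟪gradient f y, v⟫ = fderiv ℝ f y v :=
  InnerProductSpace.toDual_symm_apply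

theorem vdiv_congr {n : ℕ} {V W : Euc n → Euc n} {y : Euc n} (h : V =ᶠ[nhds y] W) :
    vdiv V y = vdiv W y := by
  simp only [vdiv, h.fderiv_eq]

theorem ContDiffOn.gradient {n : ℕ} {u : Euc n → ℝ} {O : Set (Euc n)} (hO : IsOpen O)
    (hu : ContDiffOn ℝ 2 u O) : ContDiffOn ℝ 1 (gradient u) O :=
  (InnerProductSpace.toDual ℝ (Euc n)).symm.contDiff.comp_contDiffOn
    (hu.fderiv_of_isOpen hO (by norm_num))

/-- Doubling inequality derived from a bound `N*` on the frequency function. -/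
theorem stmt16 (n : ℕ) (hn : 2 ≤ n) (O : Set (Euc n)) (hO : IsOpen O)
    (hObd : Bornology.IsBounded O) (ϰ : ℝ) (hϰ : 1 < ϰ) (σ u : Euc n → ℝ)
    (hσ : ContDiffOn ℝ 1 σ O)
    (hσbd : ∀ x ∈ O, ϰ⁻¹ ≤ σ x ∧ σ x ≤ ϰ)
    (hgradσ : ∀ x ∈ O, ‖gradient σ x‖ ≤ ϰ)
    (hu : ContDiffOn ℝ 2 u O)
    (hpde : ∀ x ∈ O, vdiv (fun y => σ y • gradient u y) x = 0)
    (δ : ℝ) (hδ : 0 < δ) (x : Euc n) (hx : x ∈ O)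
    (hxδ : δ < infDist x (frontier O))
    (Nstar : ℝ) (hNstar : 0 ≤ Nstar)
    (hfreq : ∀ ρ ∈ Ioo (0 : ℝ) δ,
        0 < Hfn σ u x ρ ∧ ρ * Dfn σ u x ρ / Hfn σ u x ρ ≤ Nstar) :
    (∀ r ρ : ℝ, 0 < r → r ≤ ρ → ρ ≤ δ →
        Hfn σ u x ρ / ρ ^ (n - 1)
          ≤ Real.exp (ϰ ^ 2 * (ρ - r)) * (ρ / r) ^ (2 * Nstar)
              * (Hfn σ u x r / r ^ (n - 1))) ∧
    (∀ r : ℝ, 0 < r → r < δ →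
        Kfn σ u x δ
            ≤ Real.exp (ϰ ^ 2 * δ) * (δ / r) ^ (2 * Nstar + n) * Kfn σ u x r ∧
        (∫ y in ball x δ, u y ^ 2)
            ≤ ϰ ^ 2 * Real.exp (ϰ ^ 2 * δ) * (δ / r) ^ (2 * Nstar + n)
                * ∫ y in ball x r, u y ^ 2) := by
  have : NeZero n := ⟨by omega⟩
  have hϰ0 : 0 < ϰ := one_pos.trans hϰ
  obtain ⟨R, hδR, hRd⟩ := exists_between hxδ
  have hRO : closedBall x R ⊆ O :=
    (closedBall_subset_ball hRd).trans (ball_infDist_frontier_subset hx)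
  have hδO : closedBall x δ ⊆ O := (closedBall_subset_closedBall hδR.le).trans hRO
  have hu1 : ContDiffOn ℝ 1 u O := hu.of_le (by norm_num)
  have hone : ∀ y ∈ O, 1 ≤ ϰ * σ y := fun y hy => by
    have := mul_le_mul_of_nonneg_left (hσbd y hy).1 hϰ0.le
    rwa [mul_inv_cancel₀ hϰ0.ne'] at this
  obtain ⟨f, hf, hfe⟩ := ContDiffOn.exists_contDiff_eqOn_closedBall (m := 1)
    (hσ.mul (hu1.pow 2)) hO hδ hδR hRO
  obtain ⟨V, hV, hVe⟩ := ContDiffOn.exists_contDiff_eqOn_closedBall (m := 1)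
    (hu1.smul (hσ.smul (hu.gradient hO))) hO hδ hδR hRO
  have hpt : ∀ s, 0 ≤ s → s ≤ δ → ∀ θ : sphere (0 : Euc n) 1,
      x + s • (θ : Euc n) ∈ closedBall x δ := fun s hs hsδ θ => by
    simpa [norm_smul, abs_of_nonneg hs] using hsδ
  set h : ℝ → ℝ := fun s => ∫ θ : sphere (0 : Euc n) 1, f (x + s • (θ : Euc n))
    ∂((volume : Measure (Euc n)).toSphere)
  have hHS : ∀ s, 0 ≤ s → s ≤ δ → Hfn σ u x s = sphIntB n x s f := by
    intro s hs hsδ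
    simp only [Hfn, sphIntB]
    congr 2
    funext θ
    exact (hfe (hpt s hs hsδ θ)).symm
  have hH : ∀ s, 0 ≤ s → s ≤ δ → Hfn σ u x s = s ^ (n - 1) * h s := hHS
  have hdivV : ∀ y ∈ ball x δ, vdiv V y = σ y * ‖gradient u y‖ ^ 2 := by
    intro y hy
    have hyO : y ∈ O := hδO (ball_subset_closedBall hy)
    have hev : V =ᶠ[nhds y] fun z => u z • (σ z • gradient u z) :=
      Filter.eventually_of_mem (isOpen_ball.mem_nhds hy) fun z hz => hVe (ball_subset_closedBall hz)
    have hgs : DifferentiableAt ℝ (fun z => σ z • gradient u z) y :=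
      ((hσ.smul (hu.gradient hO)).contDiffAt (hO.mem_nhds hyO)).differentiableAt one_ne_zero
    rw [vdiv_congr hev, vdiv_smul
      ((hu1.contDiffAt (hO.mem_nhds hyO)).differentiableAt one_ne_zero) hgs,
      hpde y hyO, ← inner_gradient_eq_fderiv, real_inner_smul_right, real_inner_self_eq_norm_sq]
    ring
  have hflux : ∀ s ∈ Ioo 0 δ, s ^ (n - 1) * ∫ θ : sphere (0 : Euc n) 1,
      ⟪(θ : Euc n), V (x + s • (θ : Euc n))⟫ ∂((volume : Measure (Euc n)).toSphere) =
        Dfn σ u x s := by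
    intro s hs
    rw [integral_sphere_flux_eq_integral_ball_vdiv x hV hs.1]
    exact setIntegral_congr_fun measurableSet_ball fun y hy =>
      hdivV y (ball_subset_ball hs.2.le hy)
  have hfc := hf.continuous
  have hVc := hV.continuous
  have hfd := hf.continuous_fderiv one_ne_zero
  have hderiv_le : ∀ s ∈ Ioo 0 δ, (∫ θ : sphere (0 : Euc n) 1,
      fderiv ℝ f (x + s • (θ : Euc n)) θ ∂((volume : Measure (Euc n)).toSphere)) ≤
        (ϰ ^ 2 + 2 * Nstar / s) * h s := by
    intro s hs
    have hpoint : ∀ θ : sphere (0 : Euc n) 1, fderiv ℝ f (x + s • (θ : Euc n)) θ ≤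
        ϰ ^ 2 * f (x + s • (θ : Euc n)) + 2 * ⟪(θ : Euc n), V (x + s • (θ : Euc n))⟫ := by
      intro θ
      have hyb : x + s • (θ : Euc n) ∈ ball x δ := by
        simpa [norm_smul, abs_of_pos hs.1] using hs.2
      set y := x + s • (θ : Euc n)
      have hyc := ball_subset_closedBall hyb
      have hyO : y ∈ O := hδO hyc
      have hσd := ((hσ.contDiffAt (hO.mem_nhds hyO)).differentiableAt one_ne_zero).hasFDerivAt
      have hud := ((hu1.contDiffAt (hO.mem_nhds hyO)).differentiableAt one_ne_zero).hasFDerivAt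
      have hev : f =ᶠ[nhds y] fun z => σ z * u z ^ 2 :=
        Filter.eventually_of_mem (isOpen_ball.mem_nhds hyb)
          fun z hz => hfe (ball_subset_closedBall hz)
      have hfy : f y = σ y * u y ^ 2 := hfe hyc
      have hVy : V y = u y • (σ y • gradient u y) := hVe hyc
      have hformula : fderiv ℝ f y θ = u y ^ 2 * ⟪gradient σ y, (θ : Euc n)⟫ +
          2 * ⟪(θ : Euc n), V y⟫ := by
        have hprod : HasFDerivAt (fun z => σ z * u z ^ 2) _ y := hσd.mul (hud.pow 2)
        rw [hev.fderiv_eq, hprod.fderiv, hVy, real_inner_smul_right,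
          real_inner_smul_right, real_inner_comm (gradient u y), inner_gradient_eq_fderiv,
          inner_gradient_eq_fderiv]
        simp
        ring
      have hinner : ⟪gradient σ y, (θ : Euc n)⟫ ≤ ϰ := by
        refine (real_inner_le_norm _ _).trans ?_
        simpa using hgradσ y hyO
      have hsq := sq_nonneg (u y)
      rw [hformula, hfy]
      have h1 := mul_le_mul_of_nonneg_left hinner hsq
      have h2 := mul_le_mul_of_nonneg_left (hone y hyO) (mul_nonneg hϰ0.le hsq)
      nlinarith
    have hI1 : Integrable (fun θ : sphere (0 : Euc n) 1 => ϰ ^ 2 * f (x + s • (θ : Euc n)))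
        ((volume : Measure (Euc n)).toSphere) := integrable_sphere_of_continuous (by fun_prop)
    have hI2 : Integrable (fun θ : sphere (0 : Euc n) 1 =>
        2 * ⟪(θ : Euc n), V (x + s • (θ : Euc n))⟫)
        ((volume : Measure (Euc n)).toSphere) := integrable_sphere_of_continuous (by fun_prop)
    have hle := integral_mono (integrable_sphere_of_continuous (by fun_prop)) (hI1.add hI2)
      hpoint
    simp only [Pi.add_apply] at hle
    rw [integral_add hI1 hI2, integral_const_mul, integral_const_mul] at hle
    refine hle.trans ?_
    obtain ⟨hHpos, hN⟩ := hfreq s hs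
    rw [div_le_iff₀ hHpos, ← hflux s hs, hH s hs.1.le hs.2.le] at hN
    have hsp : 0 < s ^ (n - 1) := pow_pos hs.1 _
    have hN' : s * (∫ θ : sphere (0 : Euc n) 1, ⟪(θ : Euc n), V (x + s • (θ : Euc n))⟫
        ∂((volume : Measure (Euc n)).toSphere)) ≤ Nstar * h s :=
      le_of_mul_le_mul_left (by linarith) hsp
    rw [← le_div_iff₀' hs.1] at hN'
    have : (ϰ ^ 2 + 2 * Nstar / s) * h s = ϰ ^ 2 * h s + 2 * (Nstar * h s / s) := by ring
    rw [this]
    linarith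
  have hgrowth : ∀ r ρ : ℝ, 0 < r → r ≤ ρ → ρ ≤ δ →
      h ρ ≤ Real.exp (ϰ ^ 2 * (ρ - r)) * (ρ / r) ^ (2 * Nstar) * h r := by
    intro r ρ hr hrρ hρδ
    have hsub : Ioo r ρ ⊆ Ioo 0 δ := Ioo_subset_Ioo hr.le hρδ
    exact le_exp_mul_rpow_mul_of_deriv_le hr hrρ
      (fun s _ => (hasDerivAt_integral_sphere x hf s).continuousAt.continuousWithinAt)
      (fun s _ => hasDerivAt_integral_sphere x hf s) fun s hs => hderiv_le s (hsub hs)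
  have hf0 : ∀ y ∈ closedBall x δ, 0 ≤ f y := fun y hy => by
    rw [hfe hy]
    exact mul_nonneg ((inv_pos.2 hϰ0).le.trans (hσbd y (hδO hy)).1) (sq_nonneg _)
  have hK : ∀ s, 0 < s → s ≤ δ → Kfn σ u x s = ∫ t in (0 : ℝ)..s, sphIntB n x t f := by
    intro s hs hsδ
    rw [← setIntegral_ball_eq_intervalIntegral x hfc hs.le]
    exact setIntegral_congr_fun measurableSet_ball fun y hy =>
      (hfe (closedBall_subset_closedBall hsδ (ball_subset_closedBall hy))).symm
  have hKbound : ∀ r, 0 < r → r < δ → Kfn σ u x δ ≤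
      Real.exp (ϰ ^ 2 * δ) * (δ / r) ^ (2 * Nstar + n) * Kfn σ u x r := by
    intro r hr hrδ
    have hSc := continuous_sphIntB x hfc
    set c := δ / r with hc
    have hc1 : 1 ≤ c := (one_le_div hr).2 hrδ.le
    have hc0 : 0 < c := one_pos.trans_le hc1
    have hcr : c * r = δ := div_mul_cancel₀ δ hr.ne'
    have hslice : ∀ s ∈ Icc 0 r, sphIntB n x (c * s) f ≤
        Real.exp (ϰ ^ 2 * δ) * c ^ (2 * Nstar) * c ^ (n - 1) * sphIntB n x s f := by
      rintro s ⟨hs0, hsr⟩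
      change (c * s) ^ (n - 1) * h (c * s) ≤ _ * (s ^ (n - 1) * h s)
      rcases hs0.eq_or_lt with rfl | hs0
      · have : (0 : ℝ) ^ (n - 1) = 0 := zero_pow (by omega)
        simp [this]
      have hcs : c * s ≤ δ := hcr ▸ mul_le_mul_of_nonneg_left hsr hc0.le
      have hg := hgrowth s (c * s) hs0 (le_mul_of_one_le_left hs0.le hc1) hcs
      rw [mul_div_cancel_right₀ c hs0.ne'] at hg
      have hh0 : 0 ≤ h s := integral_nonneg fun θ => hf0 _ (hpt s hs0.le (hsr.trans hrδ.le) θ)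
      have hexp : Real.exp (ϰ ^ 2 * (c * s - s)) ≤ Real.exp (ϰ ^ 2 * δ) := by
        gcongr
        linarith
      calc (c * s) ^ (n - 1) * h (c * s)
          ≤ (c * s) ^ (n - 1) * (Real.exp (ϰ ^ 2 * δ) * c ^ (2 * Nstar) * h s) := by
            gcongr
            exact hg.trans (by gcongr)
        _ = _ := by rw [mul_pow]; ring
    rw [hK δ hδ le_rfl, hK r hr hrδ.le]
    have hsubst := intervalIntegral.mul_integral_comp_mul_left (a := 0) (b := r)
      (f := fun t => sphIntB n x t f) c
    rw [mul_zero, hcr] at hsubst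
    have hpow : c ^ (2 * Nstar + n) = c * (c ^ (2 * Nstar) * c ^ (n - 1)) := by
      rw [Real.rpow_add hc0, Real.rpow_natCast, ← mul_pow_sub_one (NeZero.ne n) c]
      ring
    rw [← hsubst]
    calc c * ∫ s in (0 : ℝ)..r, sphIntB n x (c * s) f
        ≤ c * ∫ s in (0 : ℝ)..r,
            Real.exp (ϰ ^ 2 * δ) * c ^ (2 * Nstar) * c ^ (n - 1) * sphIntB n x s f := by
          refine mul_le_mul_of_nonneg_left (intervalIntegral.integral_mono_on hr.le ?_ ?_ hslice)
            hc0.le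
          · exact (hSc.comp (continuous_const_mul c)).intervalIntegrable _ _
          · exact (hSc.const_mul _).intervalIntegrable _ _
      _ = _ := by rw [intervalIntegral.integral_const_mul, hpow]; ring
  refine ⟨fun r ρ hr hrρ hρδ => ?_, fun r hr hrδ => ⟨hKbound r hr hrδ, ?_⟩⟩
  · have hρ : 0 < ρ := hr.trans_le hrρ
    rw [hH ρ hρ.le hρδ, hH r hr.le (hrρ.trans hρδ), mul_div_cancel_left₀ _ (pow_pos hρ _).ne',
      mul_div_cancel_left₀ _ (pow_pos hr _).ne']
    exact hgrowth r ρ hr hrρ hρδ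
  · have hIu : ∀ s, s ≤ δ → IntegrableOn (fun y => u y ^ 2) (ball x s) := fun s hs =>
      (((hu1.continuousOn.mono hδO).pow 2).integrableOn_compact
        (isCompact_closedBall x δ)).mono_set
        (ball_subset_closedBall.trans (closedBall_subset_closedBall hs))
    have hIσ : ∀ s, s ≤ δ → IntegrableOn (fun y => σ y * u y ^ 2) (ball x s) := fun s hs =>
      (((hσ.continuousOn.mono hδO).mul ((hu1.continuousOn.mono hδO).pow 2)).integrableOn_compact
        (isCompact_closedBall x δ)).mono_set
        (ball_subset_closedBall.trans (closedBall_subset_closedBall hs))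
    have hlower : ∫ y in ball x δ, u y ^ 2 ≤ ϰ * Kfn σ u x δ := by
      rw [Kfn, ← integral_const_mul]
      refine setIntegral_mono_on (hIu δ le_rfl) ((hIσ δ le_rfl).const_mul ϰ) measurableSet_ball
        fun y hy => ?_
      nlinarith [mul_le_mul_of_nonneg_right (hone y (hδO (ball_subset_closedBall hy)))
        (sq_nonneg (u y))]
    have hupper : Kfn σ u x r ≤ ϰ * ∫ y in ball x r, u y ^ 2 := by
      rw [Kfn, ← integral_const_mul]
      refine setIntegral_mono_on (hIσ r hrδ.le) ((hIu r hrδ.le).const_mul ϰ) measurableSet_ball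
        fun y hy => ?_
      exact mul_le_mul_of_nonneg_right
        (hσbd y (hδO (ball_subset_closedBall (ball_subset_ball hrδ.le hy)))).2 (sq_nonneg _)
    calc ∫ y in ball x δ, u y ^ 2
        ≤ ϰ * (Real.exp (ϰ ^ 2 * δ) * (δ / r) ^ (2 * Nstar + n) *
            (ϰ * ∫ y in ball x r, u y ^ 2)) := by
          refine hlower.trans (mul_le_mul_of_nonneg_left ((hKbound r hr hrδ).trans ?_) hϰ0.le)
          exact mul_le_mul_of_nonneg_left hupper (by positivity)
      _ = _ := by ring

end
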